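/- On the enlarged space, for every t ∈ [0,T] the following hold: (a) F̄^Δ_{t+} = ∩_{s>t} F̄^Δ_{s∧T}; (b) for every A ∈ F_t, { ω̄ = (ω,ν) ∈ Ω̄ : ω ∈ A } ∈ F̄^Δ_t; (c) for every A ∈ F_{t+}, { ω̄ = (ω,ν) ∈ Ω̄ : ω ∈ A } ∈ F̄^Δ_{t+}; (d) for every Ā ∈ F̄^Δ_t, ψ^{−1}(Ā) ∈ F_t; (e) for every Ā ∈ F̄^Δ_{t+}, ψ^{−1}(Ā) ∈ F_{t+}. -/

import Mathlib

open MeasureTheory Filter Set Topology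
open scoped ENNReal Classical

noncomputable section

namespace PathwiseSuperhedging

/-- The path space `C[0,T]`: continuous functions on `[0,T]` with the sup-norm. -/
abbrev Path (T : ℝ) := C(Set.Icc (0:ℝ) T, ℝ)

variable (T : ℝ)

instance : MeasurableSpace (Path T) := borel _
instance : BorelSpace (Path T) := ⟨rfl⟩

variable (hT : 0 ≤ T)

/-- time `0` as an element of `[0,T]`. -/
def t0 : Set.Icc (0:ℝ) T := ⟨0, le_refl 0, hT⟩

/-- clamp a real time into `[0,T]`. -/
def clamp (t : ℝ) : Set.Icc (0:ℝ) T := Set.projIcc 0 T hT t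

/-- evaluation of a path at a (clamped) real time. -/
def ev (ω : Path T) (t : ℝ) : ℝ := ω (clamp T hT t)

/-- The stopping times `σ^m_k`:  `σ^m_0 = 0` and
`σ^m_{k+1} = inf { t ≥ σ^m_k : |S_t - S_{σ^m_k}| ≥ 2^{-m} }` (equal to `T+1` if no such
time `t ≤ T` exists). -/
def sig (m : ℕ) : ℕ → Path T → ℝ
  | 0 => fun _ => 0
  | k + 1 => fun ω =>
      sInf ({t : ℝ | sig m k ω ≤ t ∧ t ≤ T ∧
        (2:ℝ) ^ (-(m:ℤ)) ≤ |ev T hT ω t - ev T hT ω (sig m k ω)|} ∪ {T + 1})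

/-- The discretized integral `𝕊^m_t = ∑_k S_{σ^m_k} (S_{σ^m_{k+1} ∧ t} - S_{σ^m_k ∧ t})`. -/
def Sm (m : ℕ) (t : ℝ) (ω : Path T) : ℝ :=
  ∑' k : ℕ, ev T hT ω (sig T hT m k ω) *
    (ev T hT ω (min (sig T hT m (k + 1) ω) t) - ev T hT ω (min (sig T hT m k ω) t))

/-- The pathwise integral `𝕊_t = liminf_m 𝕊^m_t`. -/
def SS (t : ℝ) (ω : Path T) : ℝ := Filter.liminf (fun m => Sm T hT m t ω) Filter.atTop

/-- The candidate quadratic variation `S_t² - S_0² - 2 𝕊_t`. -/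
def qvRaw (ω : Path T) (t : ℝ) : ℝ := (ev T hT ω t) ^ 2 - (ev T hT ω 0) ^ 2 - 2 * SS T hT t ω

/-- The set `Ω` of paths for which `𝕊^m → 𝕊` uniformly and
`t ↦ S_t² - S_0² - 2𝕊_t` is nondecreasing. -/
def BigOmega : Set (Path T) :=
  {ω | TendstoUniformly (fun m (t : Set.Icc (0:ℝ) T) => Sm T hT m (t : ℝ) ω)
        (fun t => SS T hT (t : ℝ) ω) Filter.atTop ∧
      MonotoneOn (qvRaw T hT ω) (Set.Icc (0:ℝ) T)}

/-- The pathwise quadratic variation `⟨ω⟩`, as an element of `C[0,T]`; it equals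
`S² - S_0² - 2𝕊` for `ω ∈ Ω` (this function being continuous there) and `0` otherwise. -/
def qv (ω : Path T) : Path T :=
  if h : ω ∈ BigOmega T hT ∧ Continuous fun t : Set.Icc (0:ℝ) T => qvRaw T hT ω (t : ℝ)
  then ⟨fun t => qvRaw T hT ω (t : ℝ), h.2⟩ else 0

/-- The raw filtration `F_t = σ(S_s : s ≤ t)` generated by the canonical process. -/
def Fraw (t : ℝ) : MeasurableSpace (Path T) :=
  ⨆ (s : Set.Icc (0:ℝ) T) (_ : (s : ℝ) ≤ t),
    MeasurableSpace.comap (fun ω : Path T => ω s) inferInstance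

/-- The right-continuous filtration `F_{t+} = ⋂_{s > t} F_{s ∧ T}`. -/
def Fplus (t : ℝ) : MeasurableSpace (Path T) :=
  ⨅ (s : ℝ) (_ : t < s), Fraw T (min s T)

/-- `τ` is a stopping time for the raw filtration `𝔽`. -/
def IsStopRaw (τ : Path T → ℝ) : Prop :=
  ∀ t ∈ Set.Icc (0:ℝ) T, MeasurableSet[Fraw T t] {ω | τ ω ≤ t}

/-- `τ` is a stopping time for the right-continuous filtration `𝔽₊`. -/
def IsStopPlus (τ : Path T → ℝ) : Prop :=
  ∀ t ∈ Set.Icc (0:ℝ) T, MeasurableSet[Fplus T t] {ω | τ ω ≤ t}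

/-- `f` is measurable with respect to the σ-field `F_{τ+}`. -/
def MeasAtStopPlus (τ f : Path T → ℝ) : Prop :=
  ∀ B : Set ℝ, MeasurableSet B → ∀ t ∈ Set.Icc (0:ℝ) T,
    MeasurableSet[Fplus T t] (f ⁻¹' B ∩ {ω | τ ω ≤ t})

/-- The set `ℋ` of simple trading strategies `H = ∑_{l=1}^L h_l 1_{(τ_l, τ_{l+1}]}`
with `𝔽₊`-stopping times `0 ≤ τ_1 ≤ ⋯ ≤ τ_{L+1} ≤ T` and bounded `F_{τ_l+}`-measurable
coefficients `h_l`. -/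
structure SimpleStrategy where
  L : ℕ
  τ : Fin (L + 1) → Path T → ℝ
  coeff : Fin L → Path T → ℝ
  τ_nonneg : ∀ ω, 0 ≤ τ 0 ω
  τ_mono : ∀ (l : Fin L) (ω), τ l.castSucc ω ≤ τ l.succ ω
  τ_le : ∀ ω, τ (Fin.last L) ω ≤ T
  τ_stop : ∀ l, IsStopPlus T (τ l)
  coeff_bdd : ∀ l, ∃ C : ℝ, ∀ ω, |coeff l ω| ≤ C
  coeff_meas : ∀ l : Fin L, MeasAtStopPlus T (τ l.castSucc) (coeff l)

/-- The pathwise stochastic integral `(H · X)_t(ω)` of a simple strategy against a process. -/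
def integ (H : SimpleStrategy T) (X : ℝ → Path T → ℝ) (t : ℝ) (ω : Path T) : ℝ :=
  ∑ l : Fin H.L, H.coeff l ω *
    (X (min (H.τ l.succ ω) t) ω - X (min (H.τ l.castSucc ω) t) ω)

/-- The canonical process `S_t(ω) = ω(t)`. -/
def Sproc (t : ℝ) (ω : Path T) : ℝ := ev T hT ω t

/-- `X` is a `Q`-`𝔽`-martingale (on the time interval `[0,T]`). -/
def IsMart (Q : Measure (Path T)) (X : ℝ → Path T → ℝ) : Prop :=
  (∀ t ∈ Set.Icc (0:ℝ) T, Integrable (X t) Q) ∧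
  ∀ s t : ℝ, s ∈ Set.Icc (0:ℝ) T → t ∈ Set.Icc (0:ℝ) T → s ≤ t →
    ∀ A : Set (Path T), MeasurableSet[Fraw T s] A →
      ∫ ω in A, X t ω ∂Q = ∫ ω in A, X s ω ∂Q

/-- `X` is a `Q`-`𝔽`-local martingale: there are `𝔽`-stopping times increasing `Q`-a.s.
to `∞` such that each stopped process is a `Q`-`𝔽`-martingale. -/
def IsLocalMart (Q : Measure (Path T)) (X : ℝ → Path T → ℝ) : Prop :=
  ∃ τ : ℕ → Path T → ℝ,
    (∀ m, IsStopRaw T (τ m)) ∧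
    (∀ᵐ ω ∂Q, Monotone (fun m => τ m ω) ∧ Tendsto (fun m => τ m ω) atTop atTop) ∧
    (∀ m, IsMart T Q (fun t ω => X (min (τ m ω) t) ω))

/-- The set `M(Ξ)` of local martingale measures concentrated on `Ξ`. -/
def MSet (Ξ : Set (Path T)) : Set (Measure (Path T)) :=
  {Q | IsProbabilityMeasure Q ∧ IsLocalMart T Q (Sproc T hT) ∧ Q Ξ = 1}

/-- The set `M_Z(Ξ)` of local martingale measures concentrated on `Ξ` with `E_Q[Z] < ∞`. -/
def MZSet (Ξ : Set (Path T)) (Z : Path T → ℝ≥0∞) : Set (Measure (Path T)) :=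
  {Q | IsProbabilityMeasure Q ∧ IsLocalMart T Q (Sproc T hT) ∧ Q Ξ = 1 ∧
       ∫⁻ ω, Z ω ∂Q ≠ ⊤}

/-- The stopped path `ω^t(s) = ω(t ∧ s)`. -/
def stopPath (ω : Path T) (t : Set.Icc (0:ℝ) T) : Path T :=
  ⟨fun s => ω ⟨min t.1 s.1, le_min t.2.1 s.2.1, (min_le_left _ _).trans t.2.2⟩,
    ω.continuous.comp ((continuous_const.min continuous_subtype_val).subtype_mk _)⟩

/-- Assumption A on the prediction set `Ξ` and its lift `Ξ̄`. -/
structure AssumptionA (Ξ : Set (Path T)) (Xibar : Set (Path T × Path T)) : Prop where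
  xi_nonempty : Ξ.Nonempty
  xibar_nonempty : Xibar.Nonempty
  xi_eq : Ξ = {ω ∈ BigOmega T hT | (ω, qv T hT ω) ∈ Xibar}
  A1 : ∃ K : ℕ → Set (Path T × Path T), (∀ n, IsCompact (K n)) ∧ Xibar = ⋃ n, K n
  A2 : ∀ p ∈ Xibar, p.2 (t0 T hT) = 0 ∧ Monotone p.2
  A3 : ∀ p ∈ Xibar, ∀ t : Set.Icc (0:ℝ) T, (stopPath T p.1 t, stopPath T p.2 t) ∈ Xibar

/-! ### The enlarged space -/

/-- The enlarged space `Ω̄ = C[0,T] × C[0,T]`. -/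
abbrev PathPair (T : ℝ) := Path T × Path T

/-- The embedding `ψ(ω) = (ω, ⟨ω⟩)`. -/
def psiMap (ω : Path T) : PathPair T := (ω, qv T hT ω)

/-- The diagonal set `Δ̄ = ψ(Ω)`. -/
def Delta : Set (PathPair T) := psiMap T hT '' BigOmega T hT

/-- The first canonical process `S̄_t(ω,ν) = ω(t)` on the enlarged space. -/
def SbarProc (t : ℝ) (p : PathPair T) : ℝ := ev T hT p.1 t

/-- The second canonical process `V̄_t(ω,ν) = ν(t)` on the enlarged space. -/
def VbarProc (t : ℝ) (p : PathPair T) : ℝ := ev T hT p.2 t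

/-- The process `𝕊̄ = (S̄² - S̄_0² - V̄)/2` on the enlarged space. -/
def SSbarProc (t : ℝ) (p : PathPair T) : ℝ :=
  ((ev T hT p.1 t) ^ 2 - (ev T hT p.1 0) ^ 2 - ev T hT p.2 t) / 2

/-- The raw filtration `F̄_t = σ(S̄_s, V̄_s : s ≤ t)` on the enlarged space. -/
def FbarRaw (t : ℝ) : MeasurableSpace (PathPair T) :=
  ⨆ (s : Set.Icc (0:ℝ) T) (_ : (s : ℝ) ≤ t),
    MeasurableSpace.comap (fun p : PathPair T => (p.1 s, p.2 s)) inferInstance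

/-- The right-continuous filtration `F̄_{t+} = ⋂_{s>t} F̄_{s ∧ T}` on the enlarged space. -/
def FbarPlus (t : ℝ) : MeasurableSpace (PathPair T) :=
  ⨅ (s : ℝ) (_ : t < s), FbarRaw T (min s T)

/-- The σ-field generated by all subsets of `Δ̄ᶜ`. -/
def nullDelta : MeasurableSpace (PathPair T) :=
  MeasurableSpace.generateFrom {N : Set (PathPair T) | N ⊆ (Delta T hT)ᶜ}

/-- The `Δ̄`-augmented raw filtration `F̄^Δ_t`. -/
def FbarDelta (t : ℝ) : MeasurableSpace (PathPair T) := FbarRaw T t ⊔ nullDelta T hT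

/-- The `Δ̄`-augmented right-continuous filtration `F̄^Δ_{t+}`. -/
def FbarDeltaPlus (t : ℝ) : MeasurableSpace (PathPair T) := FbarPlus T t ⊔ nullDelta T hT

/-- `τ` is a stopping time for the raw filtration `𝔽̄` on the enlarged space. -/
def IsStopBarRaw (τ : PathPair T → ℝ) : Prop :=
  ∀ t ∈ Set.Icc (0:ℝ) T, MeasurableSet[FbarRaw T t] {p | τ p ≤ t}

/-- `τ` is a stopping time for the filtration `𝔽̄₊^Δ`. -/
def IsStopBarDeltaPlus (τ : PathPair T → ℝ) : Prop :=
  ∀ t ∈ Set.Icc (0:ℝ) T, MeasurableSet[FbarDeltaPlus T hT t] {p | τ p ≤ t}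

/-- `f` is measurable with respect to `F̄^Δ_{τ+}`. -/
def MeasAtStopBarDeltaPlus (τ f : PathPair T → ℝ) : Prop :=
  ∀ B : Set ℝ, MeasurableSet B → ∀ t ∈ Set.Icc (0:ℝ) T,
    MeasurableSet[FbarDeltaPlus T hT t] (f ⁻¹' B ∩ {p | τ p ≤ t})

/-- The set `ℋ̄` of simple strategies on the enlarged space. -/
structure SimpleStrategyBar where
  L : ℕ
  τ : Fin (L + 1) → PathPair T → ℝ
  coeff : Fin L → PathPair T → ℝ
  τ_nonneg : ∀ p, 0 ≤ τ 0 p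
  τ_mono : ∀ (l : Fin L) (p), τ l.castSucc p ≤ τ l.succ p
  τ_le : ∀ p, τ (Fin.last L) p ≤ T
  τ_stop : ∀ l, IsStopBarDeltaPlus T hT (τ l)
  coeff_bdd : ∀ l, ∃ C : ℝ, ∀ p, |coeff l p| ≤ C
  coeff_meas : ∀ l : Fin L, MeasAtStopBarDeltaPlus T hT (τ l.castSucc) (coeff l)

/-- The pathwise stochastic integral on the enlarged space. -/
def integBar (H : SimpleStrategyBar T hT) (X : ℝ → PathPair T → ℝ) (t : ℝ)
    (p : PathPair T) : ℝ :=
  ∑ l : Fin H.L, H.coeff l p *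
    (X (min (H.τ l.succ p) t) p - X (min (H.τ l.castSucc p) t) p)

/-- `X` is a `Q̄`-`𝔽̄`-martingale on the enlarged space. -/
def IsMartBar (Q : Measure (PathPair T)) (X : ℝ → PathPair T → ℝ) : Prop :=
  (∀ t ∈ Set.Icc (0:ℝ) T, Integrable (X t) Q) ∧
  ∀ s t : ℝ, s ∈ Set.Icc (0:ℝ) T → t ∈ Set.Icc (0:ℝ) T → s ≤ t →
    ∀ A : Set (PathPair T), MeasurableSet[FbarRaw T s] A →
      ∫ p in A, X t p ∂Q = ∫ p in A, X s p ∂Q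

/-- `X` is a `Q̄`-`𝔽̄`-local martingale on the enlarged space. -/
def IsLocalMartBar (Q : Measure (PathPair T)) (X : ℝ → PathPair T → ℝ) : Prop :=
  ∃ τ : ℕ → PathPair T → ℝ,
    (∀ m, IsStopBarRaw T (τ m)) ∧
    (∀ᵐ p ∂Q, Monotone (fun m => τ m p) ∧ Tendsto (fun m => τ m p) atTop atTop) ∧
    (∀ m, IsMartBar T Q (fun t p => X (min (τ m p) t) p))

/-- The set `M̄(Ξ̄)` of measures on the enlarged space under which `S̄` and `𝕊̄` are local
martingales and which are concentrated on `Ξ̄`. -/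
def MbarSet (Xibar : Set (PathPair T)) : Set (Measure (PathPair T)) :=
  {Q | IsProbabilityMeasure Q ∧ IsLocalMartBar T Q (SbarProc T hT) ∧
       IsLocalMartBar T Q (SSbarProc T hT) ∧ Q Xibar = 1}

/-- The set `M̄_{Z̄}(Ξ̄)`. -/
def MbarZSet (Xibar : Set (PathPair T)) (Zbar : PathPair T → ℝ≥0∞) :
    Set (Measure (PathPair T)) :=
  {Q | IsProbabilityMeasure Q ∧ IsLocalMartBar T Q (SbarProc T hT) ∧
       IsLocalMartBar T Q (SSbarProc T hT) ∧ Q Xibar = 1 ∧ ∫⁻ p, Zbar p ∂Q ≠ ⊤}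

/-! ### Expectations and superhedging functionals -/

/-- The positive part of an extended real number, as an element of `[0,∞]`. -/
def erealPos (x : EReal) : ℝ≥0∞ := if x = ⊤ then ⊤ else ENNReal.ofReal x.toReal

/-- The expectation `E_Q[ξ]` of an extended-real-valued random variable, as an
extended real number (positive part minus negative part). -/
def expEReal {α : Type*} [MeasurableSpace α] (Q : Measure α) (ξ : α → EReal) : EReal :=
  ((∫⁻ x, erealPos (ξ x) ∂Q : ℝ≥0∞) : EReal) - ((∫⁻ x, erealPos (-ξ x) ∂Q : ℝ≥0∞) : EReal)

/-- The set of initial capitals `λ` that allow superhedging `ξ` on `Ξ`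
(trading in `S` and `𝕊` with simple strategies, in the liminf sense). -/
def PhiSet (Ξ : Set (Path T)) (ξ : Path T → EReal) : Set ℝ :=
  {lam : ℝ | ∃ H G : ℕ → SimpleStrategy T,
    (∀ n : ℕ, ∀ t ∈ Set.Icc (0:ℝ) T, ∀ ω ∈ Ξ,
      0 ≤ lam + integ T (H n) (Sproc T hT) t ω + integ T (G n) (SS T hT) t ω) ∧
    (∀ ω ∈ Ξ, ξ ω ≤ (lam : EReal) +
      Filter.liminf (fun n =>
        ((integ T (H n) (Sproc T hT) T ω + integ T (G n) (SS T hT) T ω : ℝ) : EReal))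
        Filter.atTop)}

/-- The superhedging price `Φ(ξ)`. -/
def Phi (Ξ : Set (Path T)) (ξ : Path T → EReal) : EReal :=
  sInf ((fun lam : ℝ => (lam : EReal)) '' PhiSet T hT Ξ ξ)

/-- The supremum of the pricing functionals `E_Q[ξ]` over `Q ∈ M(Ξ)`,
for a nonnegative claim `ξ`. -/
def supMart (Ξ : Set (Path T)) (ξ : Path T → ℝ≥0∞) : ℝ≥0∞ :=
  ⨆ Q ∈ MSet T hT Ξ, ∫⁻ ω, ξ ω ∂Q

/-- The liminf-closure `𝒢^Ξ_λ`: the smallest set of functions `C[0,T] → [-∞,∞]`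
containing `λ + (H·S)_T` for admissible simple `H` and closed under countable liminf. -/
inductive GG (Ξ : Set (Path T)) (lam : ℝ) : (Path T → EReal) → Prop
  | base (H : SimpleStrategy T)
      (hadm : ∀ t ∈ Set.Icc (0:ℝ) T, ∀ ω ∈ Ξ, 0 ≤ lam + integ T H (Sproc T hT) t ω) :
      GG Ξ lam (fun ω => ((lam + integ T H (Sproc T hT) T ω : ℝ) : EReal))
  | lim (X : ℕ → Path T → EReal) (h : ∀ n, GG Ξ lam (X n)) :
      GG Ξ lam (fun ω => Filter.liminf (fun n => X n ω) Filter.atTop)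

/-- The superhedging price `Φ^cl(ξ)` defined via the liminf-closure. -/
def PhiCl (Ξ : Set (Path T)) (ξ : Path T → EReal) : EReal :=
  sInf {x : EReal | ∃ lam : ℝ, x = (lam : EReal) ∧
    ∃ Y : Path T → EReal, GG T hT Ξ lam Y ∧ ∀ ω ∈ Ξ, ξ ω ≤ Y ω}


/-- The set of initial capitals allowing superhedging on the enlarged space
(superhedging on `Δ̄ ∩ Ξ̄`). -/
def PhiBarSet (Xibar : Set (PathPair T)) (ξ : PathPair T → EReal) : Set ℝ :=
  {lam : ℝ | ∃ H G : ℕ → SimpleStrategyBar T hT,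
    (∀ n : ℕ, ∀ t ∈ Set.Icc (0:ℝ) T, ∀ p ∈ Delta T hT ∩ Xibar,
      0 ≤ lam + integBar T hT (H n) (SbarProc T hT) t p
            + integBar T hT (G n) (SSbarProc T hT) t p) ∧
    (∀ p ∈ Delta T hT ∩ Xibar, ξ p ≤ (lam : EReal) +
      Filter.liminf (fun n =>
        ((integBar T hT (H n) (SbarProc T hT) T p
          + integBar T hT (G n) (SSbarProc T hT) T p : ℝ) : EReal)) Filter.atTop)}

/-- The superhedging price `Φ̄(ξ̄)` on the enlarged space. -/
def PhiBar (Xibar : Set (PathPair T)) (ξ : PathPair T → EReal) : EReal :=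
  sInf ((fun lam : ℝ => (lam : EReal)) '' PhiBarSet T hT Xibar ξ)

/-- The supremum of pricing functionals over `M̄(Ξ̄)` for a nonnegative claim. -/
def supMartBar (Xibar : Set (PathPair T)) (ξ : PathPair T → ℝ≥0∞) : ℝ≥0∞ :=
  ⨆ Q ∈ MbarSet T hT Xibar, ∫⁻ p, ξ p ∂Q

/-- Assumption B on the prediction set `Ξ`, determined by a growth function `Z̄`
(with values in `[1,∞]`). -/
structure AssumptionB (Ξ : Set (Path T)) (Zbar : PathPair T → ℝ≥0∞) : Prop where
  xi_nonempty : Ξ.Nonempty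
  one_le : ∀ p, 1 ≤ Zbar p
  xi_eq : Ξ = {ω ∈ BigOmega T hT | Zbar (ω, qv T hT ω) ≠ ⊤}
  B1 : ∀ c : ℝ≥0∞, c ≠ ⊤ → IsCompact {p : PathPair T | Zbar p ≤ c}
  B2 : ∀ p : PathPair T, Zbar p ≠ ⊤ → p.2 (t0 T hT) = 0 ∧ Monotone p.2
  B3 : ∀ p : PathPair T, ENNReal.ofReal (‖p.1‖ + ‖p.2‖) ≤ Zbar p

/-- The set of initial capitals allowing `Z`-admissible superhedging of `ξ` on `Ξ`. -/
def PhiZSet (Ξ : Set (Path T)) (Z : Path T → ℝ≥0∞) (ξ : Path T → EReal) : Set ℝ :=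
  {lam : ℝ | ∃ c : ℝ, 0 ≤ c ∧ ∃ H G : ℕ → SimpleStrategy T,
    (∀ n : ℕ, ∀ ω ∈ Ξ,
      -(c * (Z ω).toReal) ≤
        lam + integ T (H n) (Sproc T hT) T ω + integ T (G n) (SS T hT) T ω) ∧
    (∀ ω ∈ Ξ, ξ ω ≤ (lam : EReal) +
      Filter.liminf (fun n =>
        ((integ T (H n) (Sproc T hT) T ω + integ T (G n) (SS T hT) T ω : ℝ) : EReal))
        Filter.atTop)}

/-- The superhedging price `Φ^Z(ξ)`. -/
def PhiZ (Ξ : Set (Path T)) (Z : Path T → ℝ≥0∞) (ξ : Path T → EReal) : EReal :=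
  sInf ((fun lam : ℝ => (lam : EReal)) '' PhiZSet T hT Ξ Z ξ)

/-- The `α`-Hölder norm `‖ω‖_α = |ω(0)| + sup_{s ≠ t} |ω(t) - ω(s)| / |t-s|^α`,
with values in `[0,∞]`. -/
def holderNormE (α : ℝ) (ω : Path T) : ℝ≥0∞ :=
  ENNReal.ofReal |ω (t0 T hT)| +
    ⨆ (s : Set.Icc (0:ℝ) T) (t : Set.Icc (0:ℝ) T) (_ : s ≠ t),
      ENNReal.ofReal (|ω t - ω s| / |t.1 - s.1| ^ α)

/-- The set of Hölder continuous paths `⋃_n { ω : ‖ω‖_{1/n} ≤ n }`. -/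
def CHolder : Set (Path T) :=
  ⋃ n : ℕ, {ω : Path T | 0 < n ∧ holderNormE T hT (1 / n) ω ≤ (n : ℝ≥0∞)}

end PathwiseSuperhedging

namespace PathwiseSuperhedging

section Aux

variable {T : ℝ} (hT : 0 ≤ T)

theorem ev_cont (ω : Path T) : Continuous (ev T hT ω) :=
  ω.continuous.comp (continuous_projIcc (h := hT))

theorem ev_coe (ω : Path T) (s : Set.Icc (0:ℝ) T) : ev T hT ω (s : ℝ) = ω s := by
  unfold ev clamp
  rw [Set.projIcc_val]

theorem sig_succ (m k : ℕ) (ω : Path T) : sig T hT m (k+1) ω =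
      sInf ({t : ℝ | sig T hT m k ω ≤ t ∧ t ≤ T ∧
        (2:ℝ) ^ (-(m:ℤ)) ≤ |ev T hT ω t - ev T hT ω (sig T hT m k ω)|} ∪ {T + 1}) := by
  rw [sig]

theorem le_sig_succ (m k : ℕ) (ω : Path T) (c : ℝ) (hc : c ≤ T + 1)
    (h : ∀ t, sig T hT m k ω ≤ t → t ≤ T →
      (2:ℝ) ^ (-(m:ℤ)) ≤ |ev T hT ω t - ev T hT ω (sig T hT m k ω)| → c ≤ t) :
    c ≤ sig T hT m (k+1) ω := by
  rw [sig_succ]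
  apply le_csInf ⟨T+1, Or.inr rfl⟩
  rintro b (hb | hb)
  · exact h b hb.1 hb.2.1 hb.2.2
  · rw [hb]; exact hc

theorem sig_nonneg (m k : ℕ) (ω : Path T) : 0 ≤ sig T hT m k ω := by
  induction k with
  | zero => simp [sig]
  | succ k ih =>
    apply le_sig_succ
    · linarith
    · intro t h1 _ _; linarith

theorem sig_mono_ge (m k : ℕ) (ω : Path T) (s : ℝ) (hs : s ≤ T)
    (h : s ≤ sig T hT m k ω) : s ≤ sig T hT m (k+1) ω := by
  apply le_sig_succ
  · linarith
  · intro t h1 _ _; linarith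

theorem sig_large (m : ℕ) (ω : Path T) : ∃ K : ℕ, ∀ k, K ≤ k → T ≤ sig T hT m k ω := by
  have huc : UniformContinuous (ev T hT ω) :=
    (CompactSpace.uniformContinuous_of_continuous ω.continuous).comp
      (LipschitzWith.projIcc hT).uniformContinuous
  have hδ : (0:ℝ) < (2:ℝ) ^ (-(m:ℤ)) := by positivity
  obtain ⟨η, hη, h⟩ := Metric.uniformContinuous_iff.1 huc _ hδ
  have key : ∀ k : ℕ, min (k * η) (T + 1) ≤ sig T hT m k ω := by
    intro k
    induction k with
    | zero => simp [sig]
    | succ k ih =>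
      apply le_sig_succ
      · exact min_le_right _ _
      · intro t h1 h2 h3
        have h4 : η ≤ t - sig T hT m k ω := by
          by_contra hcon
          push Not at hcon
          have := h (a := t) (b := sig T hT m k ω) (by
            rw [Real.dist_eq, abs_of_nonneg (by linarith)]; exact hcon)
          rw [Real.dist_eq] at this
          linarith
        rcases min_le_iff.1 ih with h5 | h5
        · apply min_le_iff.2; left; push_cast; linarith
        · linarith
  obtain ⟨K, hK⟩ := exists_nat_gt (T / η)
  refine ⟨K, fun k hk => ?_⟩
  have h1 := key k
  have h2 : T < k * η := by
    rw [div_lt_iff₀ hη] at hK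
    have : (K:ℝ) ≤ k := by exact_mod_cast hk
    nlinarith
  rcases min_le_iff.1 h1 with h5 | h5 <;> linarith

theorem Sm_term_zero (m k : ℕ) (ω : Path T) (s : ℝ) (hs : s ≤ T)
    (h : s ≤ sig T hT m k ω) :
    ev T hT ω (min (sig T hT m (k + 1) ω) s) - ev T hT ω (min (sig T hT m k ω) s) = 0 := by
  rw [min_eq_right h, min_eq_right (sig_mono_ge hT m k ω s hs h), sub_self]

theorem Sm_hasSum (m : ℕ) (ω : Path T) : ∃ K : ℕ, ∀ n, K ≤ n → ∀ s ≤ T,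
    Sm T hT m s ω = ∑ k ∈ Finset.range n, ev T hT ω (sig T hT m k ω) *
    (ev T hT ω (min (sig T hT m (k + 1) ω) s) - ev T hT ω (min (sig T hT m k ω) s)) := by
  obtain ⟨K, hK⟩ := sig_large hT m ω
  refine ⟨K, fun n hn s hs => ?_⟩
  unfold Sm
  apply tsum_eq_sum
  intro k hk
  rw [Sm_term_zero hT m k ω s hs, mul_zero]
  exact hs.trans (hK k (hn.trans (by simpa using hk)))

theorem Sm_cont (m : ℕ) (ω : Path T) :
    Continuous (fun t : Set.Icc (0:ℝ) T => Sm T hT m (t:ℝ) ω) := by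
  obtain ⟨K, hK⟩ := Sm_hasSum hT m ω
  have : (fun t : Set.Icc (0:ℝ) T => Sm T hT m (t:ℝ) ω) = fun t : Set.Icc (0:ℝ) T =>
    ∑ k ∈ Finset.range K, ev T hT ω (sig T hT m k ω) *
    (ev T hT ω (min (sig T hT m (k + 1) ω) t) - ev T hT ω (min (sig T hT m k ω) t)) := by
    ext t
    exact hK K le_rfl t t.2.2
  rw [this]
  have he := ev_cont hT ω
  fun_prop

theorem qvRaw_cont (ω : Path T) (h : ω ∈ BigOmega T hT) :
    Continuous fun t : Set.Icc (0:ℝ) T => qvRaw T hT ω (t : ℝ) := by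
  have h1 : Continuous fun t : Set.Icc (0:ℝ) T => SS T hT (t:ℝ) ω :=
    h.1.continuous (Eventually.of_forall fun m => Sm_cont hT m ω).frequently
  have he := ev_cont hT ω
  unfold qvRaw
  fun_prop

theorem qv_apply (ω : Path T) (h : ω ∈ BigOmega T hT) (s : Set.Icc (0:ℝ) T) :
    qv T hT ω s = qvRaw T hT ω (s:ℝ) := by
  unfold qv
  rw [dif_pos ⟨h, qvRaw_cont hT ω h⟩]
  rfl

/-! measurability -/

include hT in
theorem meas_exists {α : Type*} [MeasurableSpace α] (g : ℝ → α → ℝ)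
    (hc : ∀ x, Continuous fun u => g u x) (hm : ∀ u, Measurable (g u)) (δ : ℝ) :
    MeasurableSet {x | ∃ u ∈ Set.Icc (0:ℝ) T, δ ≤ g u x} := by
  have : {x | ∃ u ∈ Set.Icc (0:ℝ) T, δ ≤ g u x} =
      ⋂ n : ℕ, ⋃ q : ℚ, {x | δ - 1 / ((n:ℝ) + 1) < g (Set.projIcc 0 T hT (q:ℝ)) x} := by
    ext x
    have hc' : Continuous fun q : ℝ => g (Set.projIcc 0 T hT q) x :=
      (hc x).comp (continuous_subtype_val.comp continuous_projIcc)
    simp only [mem_ofPred_eq, mem_iInter, mem_iUnion]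
    constructor
    · rintro ⟨u, hu, h⟩ n
      have hpos : (0:ℝ) < 1 / ((n:ℝ) + 1) := by positivity
      have ho : IsOpen {q : ℝ | δ - 1 / ((n:ℝ) + 1) < g (Set.projIcc 0 T hT q) x} :=
        isOpen_lt continuous_const hc'
      obtain ⟨q, hq⟩ := (Rat.denseRange_cast (𝕜 := ℝ)).exists_mem_open ho ⟨u, by
        simp only [mem_ofPred_eq, Set.projIcc_of_mem hT hu]
        linarith⟩
      exact ⟨q, hq⟩
    · intro h
      obtain ⟨u, hu, hmax⟩ := (isCompact_Icc (a := (0:ℝ)) (b := T)).exists_isMaxOn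
        ⟨0, le_rfl, hT⟩ (hc x).continuousOn
      refine ⟨u, hu, ?_⟩
      by_contra hcon
      push Not at hcon
      obtain ⟨n, hn⟩ := exists_nat_one_div_lt (sub_pos.2 hcon)
      obtain ⟨q, hq⟩ := h n
      have := hmax (Set.projIcc 0 T hT (q:ℝ)).2
      simp only [mem_ofPred_eq] at this
      linarith
  rw [this]
  exact MeasurableSet.iInter fun n => MeasurableSet.iUnion fun q =>
    measurableSet_lt measurable_const (hm _)

variable {α : Type*} [MeasurableSpace α] (W : α → Path T) {s : ℝ} (hs : s ∈ Set.Icc (0:ℝ) T)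
  (hW : ∀ u : Set.Icc (0:ℝ) T, (u:ℝ) ≤ s → Measurable fun x => W x u)

include hs hW in
theorem meas_ev (Y : α → ℝ) (hY : Measurable Y) (hYs : ∀ x, Y x ≤ s) :
    Measurable fun x => ev T hT (W x) (Y x) := by
  have h := measurable_uncurry_of_continuous_of_measurable
    (u := fun (v : ℝ) (x : α) => ev T hT (W x) (min v s))
    (fun x => (ev_cont hT (W x)).comp (continuous_id.min continuous_const))
    (fun v => hW _ (by
      unfold clamp
      rw [Set.coe_projIcc]
      exact max_le hs.1 ((min_le_right _ _).trans (min_le_right _ _))))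
  have h2 := h.comp (hY.prodMk measurable_id)
  convert h2 using 2 with x
  simp [Function.uncurry, min_eq_left (hYs x)]

theorem sig_le_iff (m k : ℕ) (ω : Path T) (s a : ℝ) (hs : s ≤ T) (ha : a < s) :
    min (sig T hT m (k+1) ω) s ≤ a ↔ ∃ u ∈ Set.Icc (0:ℝ) T, (2:ℝ) ^ (-(m:ℤ)) ≤
      |ev T hT ω (min (min (sig T hT m k ω) s + |u|) a) -
        ev T hT ω (min (min (sig T hT m k ω) s) a)| := by
  have hδ : (0:ℝ) < (2:ℝ) ^ (-(m:ℤ)) := by positivity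
  have h0 := sig_nonneg hT m k ω
  have hbdd : BddBelow ({t : ℝ | sig T hT m k ω ≤ t ∧ t ≤ T ∧
        (2:ℝ) ^ (-(m:ℤ)) ≤ |ev T hT ω t - ev T hT ω (sig T hT m k ω)|} ∪ {T + 1}) := by
    refine ⟨0, ?_⟩
    rintro b (hb | hb)
    · exact h0.trans hb.1
    · rw [hb]; linarith
  constructor
  · intro h
    have h1 : sig T hT m (k+1) ω ≤ a := by
      rcases min_le_iff.1 h with h | h
      · exact h
      · linarith
    have hcl : IsClosed ({t : ℝ | sig T hT m k ω ≤ t ∧ t ≤ T ∧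
        (2:ℝ) ^ (-(m:ℤ)) ≤ |ev T hT ω t - ev T hT ω (sig T hT m k ω)|} ∪ {T + 1}) := by
      refine IsClosed.union ?_ isClosed_singleton
      have he := ev_cont hT ω
      exact (isClosed_le continuous_const continuous_id).inter
        ((isClosed_le continuous_id continuous_const).inter
          (isClosed_le continuous_const (he.sub continuous_const).abs))
    have hmem := hcl.csInf_mem ⟨T+1, Or.inr rfl⟩ hbdd
    rw [← sig_succ] at hmem
    rcases hmem with ⟨h2, h3, h4⟩ | h2
    · refine ⟨sig T hT m (k+1) ω - sig T hT m k ω, ⟨by linarith, by linarith⟩, ?_⟩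
      rw [abs_of_nonneg (by linarith : 0 ≤ sig T hT m (k+1) ω - sig T hT m k ω),
        min_eq_left (by linarith : sig T hT m k ω ≤ s), add_sub_cancel, min_eq_left h1,
        min_eq_left (by linarith)]
      exact h4
    · have h2' : sig T hT m (k+1) ω = T + 1 := h2
      linarith
  · rintro ⟨u, hu, h⟩
    have hX : min (sig T hT m k ω) s < a := by
      by_contra hcon
      push Not at hcon
      have := abs_nonneg u
      rw [min_eq_right hcon, min_eq_right (by linarith), sub_self, abs_zero] at h
      linarith
    have hX2 : sig T hT m k ω < a := by
      rcases min_lt_iff.1 hX with h | h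
      · exact h
      · linarith
    rw [min_eq_left hX.le, min_eq_left (by linarith : sig T hT m k ω ≤ s)] at h
    refine (min_le_left _ _).trans (le_trans ?_ (min_le_right (sig T hT m k ω + |u|) a))
    rw [sig_succ]
    refine csInf_le hbdd (Or.inl ⟨?_, ?_, h⟩)
    · have := abs_nonneg u
      exact le_min (by linarith) hX2.le
    · exact (min_le_right _ _).trans (by linarith)

include hs hW in
theorem meas_sig (m k : ℕ) : Measurable fun x => min (sig T hT m k (W x)) s := by
  induction k with
  | zero => simp [sig]
  | succ k ih =>
    apply measurable_of_Iic
    intro a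
    by_cases ha : a < s
    · have : (fun x => min (sig T hT m (k+1) (W x)) s) ⁻¹' Iic a =
        {x | ∃ u ∈ Set.Icc (0:ℝ) T, (2:ℝ) ^ (-(m:ℤ)) ≤
          |ev T hT (W x) (min (min (sig T hT m k (W x)) s + |u|) a) -
          ev T hT (W x) (min (min (sig T hT m k (W x)) s) a)|} := by
        ext x
        exact sig_le_iff hT m k (W x) s a hs.2 ha
      rw [this]
      apply meas_exists hT
      · intro x
        have he := ev_cont hT (W x)
        fun_prop
      · intro u
        have h1 := meas_ev hT W hs hW
          (fun x => min (min (sig T hT m k (W x)) s + |u|) a)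
          ((ih.add_const _).min measurable_const) (fun x => (min_le_right _ _).trans ha.le)
        have h2 := meas_ev hT W hs hW
          (fun x => min (min (sig T hT m k (W x)) s) a)
          (ih.min measurable_const) (fun x => (min_le_right _ _).trans ha.le)
        exact continuous_abs.measurable.comp (h1.sub h2)
    · have : (fun x => min (sig T hT m (k+1) (W x)) s) ⁻¹' Iic a = univ := by
        ext x
        simp only [mem_preimage, mem_Iic, mem_univ, iff_true]
        exact (min_le_right _ _).trans (not_lt.1 ha)
      rw [this]
      exact MeasurableSet.univ

include hs hW in
theorem meas_Sm (m : ℕ) : Measurable fun x => Sm T hT m s (W x) := by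
  have hX : ∀ k, Measurable fun x => ev T hT (W x) (min (sig T hT m k (W x)) s) := fun k =>
    meas_ev hT W hs hW _ (meas_sig hT W hs hW m k) (fun x => min_le_right _ _)
  refine measurable_of_tendsto_metrizable (f := fun n x => ∑ k ∈ Finset.range n,
    ev T hT (W x) (min (sig T hT m k (W x)) s) *
    (ev T hT (W x) (min (sig T hT m (k + 1) (W x)) s) -
      ev T hT (W x) (min (sig T hT m k (W x)) s))) ?_ ?_
  · intro n
    exact Finset.measurable_sum _ fun k _ => (hX k).mul ((hX (k+1)).sub (hX k))
  · rw [tendsto_pi_nhds]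
    intro x
    obtain ⟨K, hK⟩ := Sm_hasSum hT m (W x)
    apply tendsto_const_nhds.congr'
    filter_upwards [eventually_ge_atTop K] with n hn
    rw [hK n hn s hs.2]
    apply Finset.sum_congr rfl
    intro k _
    by_cases h : s ≤ sig T hT m k (W x)
    · rw [Sm_term_zero hT m k (W x) s hs.2 h, mul_zero, mul_zero]
    · rw [min_eq_left (not_le.1 h).le]

include hs hW in
theorem meas_qvRaw : Measurable fun x => qvRaw T hT (W x) s := by
  have h1 : Measurable fun x => SS T hT s (W x) := Measurable.liminf (meas_Sm hT W hs hW)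
  have h2 := meas_ev hT W hs hW (fun _ => s) measurable_const (fun _ => le_rfl)
  have h3 := meas_ev hT W hs hW (fun _ => 0) measurable_const (fun _ => hs.1)
  exact ((h2.pow_const 2).sub (h3.pow_const 2)).sub (h1.const_mul 2)

end Aux

theorem Fraw_mono (T : ℝ) : Monotone (Fraw T) := fun _ _ h =>
  iSup_mono fun _ => iSup_mono' fun hs => ⟨hs.trans h, le_rfl⟩

theorem FbarRaw_mono (T : ℝ) : Monotone (FbarRaw T) := fun _ _ h =>
  iSup_mono fun _ => iSup_mono' fun hs => ⟨hs.trans h, le_rfl⟩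

theorem Fraw_eval (T : ℝ) (t : ℝ) (u : Set.Icc (0:ℝ) T) (hu : (u:ℝ) ≤ t) :
    @Measurable _ _ (Fraw T t) _ (fun ω : Path T => ω u) :=
  Measurable.of_comap_le (le_iSup₂_of_le u hu le_rfl)

theorem Fraw_qvRaw (T : ℝ) (hT : 0 ≤ T) (t : ℝ) (u : Set.Icc (0:ℝ) T) (hu : (u:ℝ) ≤ t) :
    @Measurable _ _ (Fraw T t) _ (fun ω : Path T => qvRaw T hT ω u) :=
  @meas_qvRaw T hT (Path T) (Fraw T t) id u u.2
    (fun v hv => Fraw_eval T t v (hv.trans hu))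

theorem limsup_trace {β : Type*} (G : ℝ → MeasurableSpace β) (hG : Monotone G) (t T : ℝ)
    (A E : Set β)
    (h : ∀ s, t < s → ∃ B, MeasurableSet[G (min s T)] B ∧ A ∩ E = B ∩ E) :
    ∃ B, MeasurableSet[⨅ (s : ℝ) (_ : t < s), G (min s T)] B ∧ A ∩ E = B ∩ E := by
  have h' : ∀ n : ℕ, ∃ B, MeasurableSet[G (min (t + 1 / ((n:ℝ) + 1)) T)] B ∧ A ∩ E = B ∩ E :=
    fun n => h _ (by have : (0:ℝ) < 1 / ((n:ℝ) + 1) := by positivity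
                     linarith)
  choose B hB hBE using h'
  refine ⟨⋂ n : ℕ, ⋃ k : ℕ, B (n + k), ?_, ?_⟩
  · simp only [MeasurableSpace.measurableSet_iInf]
    intro s hs
    obtain ⟨N, hN⟩ := exists_nat_one_div_lt (sub_pos.2 hs)
    have heq : (⋂ n : ℕ, ⋃ k : ℕ, B (n + k)) = ⋂ n : ℕ, ⋃ k : ℕ, B (N + n + k) := by
      ext x
      simp only [mem_iInter, mem_iUnion]
      constructor
      · intro hx n
        exact hx (N + n)
      · intro hx n
        obtain ⟨k, hk⟩ := hx n
        exact ⟨N + k, by rwa [show n + (N + k) = N + n + k by ring]⟩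
    rw [heq]
    refine MeasurableSet.iInter fun n => MeasurableSet.iUnion fun k => ?_
    refine hG (min_le_min_right T ?_) _ (hB (N + n + k))
    have : 1 / (((N + n + k : ℕ):ℝ) + 1) ≤ 1 / ((N:ℝ) + 1) := by
      apply one_div_le_one_div_of_le (by positivity)
      push_cast
      have : (0:ℝ) ≤ n := by positivity
      have : (0:ℝ) ≤ k := by positivity
      linarith
    linarith
  · ext x
    simp only [mem_inter_iff, mem_iInter, mem_iUnion]
    have hx : ∀ n, x ∈ E → (x ∈ A ↔ x ∈ B n) := fun n hE => by
      have := Set.ext_iff.1 (hBE n) x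
      simpa [hE] using this
    constructor
    · rintro ⟨hA, hE⟩
      exact ⟨fun n => ⟨0, (hx _ hE).1 hA⟩, hE⟩
    · rintro ⟨hA, hE⟩
      obtain ⟨k, hk⟩ := hA 0
      exact ⟨(hx _ hE).2 hk, hE⟩

theorem comap_null (T : ℝ) (hT : 0 ≤ T) {β : Type*} (f : β → PathPair T)
    (hf : ∀ x, f x ∈ Delta T hT) (m : MeasurableSpace β) :
    MeasurableSpace.comap f (nullDelta T hT) ≤ m := by
  unfold nullDelta
  rw [MeasurableSpace.comap_generateFrom]
  apply MeasurableSpace.generateFrom_le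
  rintro _ ⟨N, hN, rfl⟩
  have : f ⁻¹' N = ∅ := by
    ext x
    simp only [mem_preimage, mem_empty_iff_false, iff_false]
    exact fun hx => hN hx (hf x)
  rw [this]
  exact MeasurableSet.empty

theorem sup_null_iff (T : ℝ) (hT : 0 ≤ T) (m : MeasurableSpace (PathPair T))
    (A : Set (PathPair T)) : MeasurableSet[m ⊔ nullDelta T hT] A ↔
    ∃ B, MeasurableSet[m] B ∧ A ∩ Delta T hT = B ∩ Delta T hT := by
  constructor
  · intro hA
    have h1 : MeasurableSpace.comap (Subtype.val : Delta T hT → PathPair T)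
        (m ⊔ nullDelta T hT) ≤ MeasurableSpace.comap Subtype.val m := by
      rw [MeasurableSpace.comap_sup]
      exact sup_le le_rfl (comap_null T hT _ (fun x => x.2) _)
    obtain ⟨B, hB, hBA⟩ := h1 _ ⟨A, hA, rfl⟩
    refine ⟨B, hB, ?_⟩
    rw [Subtype.preimage_coe_eq_preimage_coe_iff] at hBA
    rw [inter_comm A, inter_comm B]
    exact hBA.symm
  · rintro ⟨B, hB, hBA⟩
    have hn : ∀ N : Set (PathPair T), N ⊆ (Delta T hT)ᶜ →
        MeasurableSet[m ⊔ nullDelta T hT] N := fun N hN =>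
      (le_sup_right : nullDelta T hT ≤ m ⊔ nullDelta T hT) _
        (MeasurableSpace.measurableSet_generateFrom hN)
    have hB' : MeasurableSet[m ⊔ nullDelta T hT] B :=
      (le_sup_left : m ≤ m ⊔ nullDelta T hT) _ hB
    have hD := (hn _ Subset.rfl).of_compl
    have : A = (B ∩ Delta T hT) ∪ (A ∩ (Delta T hT)ᶜ) := by
      rw [← hBA, inter_union_compl]
    rw [this]
    exact (hB'.inter hD).union (hn _ inter_subset_right)

theorem psi_trace (T : ℝ) (hT : 0 ≤ T) (t : ℝ) (Abar : Set (PathPair T))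
    (hA : MeasurableSet[FbarDelta T hT t] Abar) :
    ∃ B : Set (Path T), MeasurableSet[Fraw T t] B ∧
        psiMap T hT ⁻¹' Abar ∩ BigOmega T hT = B ∩ BigOmega T hT := by
  have h1 : MeasurableSpace.comap (fun ω : BigOmega T hT => psiMap T hT ω)
      (FbarDelta T hT t) ≤ MeasurableSpace.comap Subtype.val (Fraw T t) := by
    unfold FbarDelta
    rw [MeasurableSpace.comap_sup]
    refine sup_le ?_ (comap_null T hT _ (fun x => mem_image_of_mem _ x.2) _)
    unfold FbarRaw
    simp only [MeasurableSpace.comap_iSup, MeasurableSpace.comap_comp]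
    refine iSup₂_le fun s hs => ?_
    have h2 : ((fun p : PathPair T => (p.1 s, p.2 s)) ∘
        fun ω : BigOmega T hT => psiMap T hT ω) =
        (fun ω : Path T => (ω s, qvRaw T hT ω s)) ∘ Subtype.val := by
      ext ω
      · rfl
      · exact qv_apply hT ω.1 ω.2 s
    rw [h2, ← MeasurableSpace.comap_comp]
    apply MeasurableSpace.comap_mono
    have h3 : @Measurable _ _ (Fraw T t) _ (fun ω : Path T => (ω s, qvRaw T hT ω s)) :=
      Measurable.prodMk (Fraw_eval T t s hs) (Fraw_qvRaw T hT t s hs)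
    exact h3.comap_le
  obtain ⟨B, hB, hBA⟩ := h1 _ ⟨Abar, hA, rfl⟩
  refine ⟨B, hB, ?_⟩
  have hBA' : (Subtype.val : BigOmega T hT → Path T) ⁻¹' B =
    Subtype.val ⁻¹' (psiMap T hT ⁻¹' Abar) := hBA
  rw [Subtype.preimage_coe_eq_preimage_coe_iff] at hBA'
  rw [inter_comm, inter_comm B]
  exact hBA'.symm

theorem fst_lift (T : ℝ) (t : ℝ) (A : Set (Path T)) (hA : MeasurableSet[Fraw T t] A) :
    MeasurableSet[FbarRaw T t] {p : PathPair T | p.1 ∈ A} := by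
  have h : MeasurableSpace.comap (Prod.fst : PathPair T → Path T) (Fraw T t) ≤ FbarRaw T t := by
    unfold Fraw
    simp only [MeasurableSpace.comap_iSup, MeasurableSpace.comap_comp]
    refine iSup₂_le fun s hs => le_trans ?_ (le_iSup₂_of_le s hs le_rfl)
    have h2 : ((fun ω : Path T => ω s) ∘ (Prod.fst : PathPair T → Path T)) =
      Prod.fst ∘ fun p : PathPair T => (p.1 s, p.2 s) := rfl
    rw [h2, ← MeasurableSpace.comap_comp]
    exact MeasurableSpace.comap_mono measurable_fst.comap_le
  exact h _ ⟨A, hA, rfl⟩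

theorem partA (T : ℝ) (hT : 0 ≤ T) (t : ℝ) :
    FbarDeltaPlus T hT t = ⨅ (s : ℝ) (_ : t < s), FbarDelta T hT (min s T) := by
  apply le_antisymm
  · refine sup_le ?_ ?_
    · exact iInf₂_mono fun s hs => le_sup_left
    · exact le_iInf₂ fun s hs => le_sup_right
  · intro A hA
    simp only [MeasurableSpace.measurableSet_iInf] at hA
    exact (sup_null_iff T hT _ A).2 (limsup_trace (FbarRaw T) (FbarRaw_mono T) t T A _
      fun s hs => (sup_null_iff T hT _ A).1 (hA s hs))

/-- **Lemma 4.2 (transfer of adaptedness between `Ω` and the enlarged space `Ω̄`).**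
(a) `F̄^Δ_{t+} = ⋂_{s>t} F̄^Δ_{s∧T}`; (b)-(c) sets of the form `{ω̄ : ω ∈ A}` with
`A ∈ F_t` (resp. `F_{t+}`) belong to `F̄^Δ_t` (resp. `F̄^Δ_{t+}`); (d)-(e) preimages
under `ψ` of sets in `F̄^Δ_t` (resp. `F̄^Δ_{t+}`) belong to the trace on `Ω` of `F_t`
(resp. `F_{t+}`). -/
theorem filtration_transfer (T : ℝ) (hT : 0 ≤ T) (t : ℝ) (ht : t ∈ Set.Icc (0:ℝ) T) :
    (FbarDeltaPlus T hT t = ⨅ (s : ℝ) (_ : t < s), FbarDelta T hT (min s T)) ∧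
    (∀ A : Set (Path T), MeasurableSet[Fraw T t] A →
      MeasurableSet[FbarDelta T hT t] {p : PathPair T | p.1 ∈ A}) ∧
    (∀ A : Set (Path T), MeasurableSet[Fplus T t] A →
      MeasurableSet[FbarDeltaPlus T hT t] {p : PathPair T | p.1 ∈ A}) ∧
    (∀ Abar : Set (PathPair T), MeasurableSet[FbarDelta T hT t] Abar →
      ∃ B : Set (Path T), MeasurableSet[Fraw T t] B ∧
        psiMap T hT ⁻¹' Abar ∩ BigOmega T hT = B ∩ BigOmega T hT) ∧
    (∀ Abar : Set (PathPair T), MeasurableSet[FbarDeltaPlus T hT t] Abar →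
      ∃ B : Set (Path T), MeasurableSet[Fplus T t] B ∧
        psiMap T hT ⁻¹' Abar ∩ BigOmega T hT = B ∩ BigOmega T hT) := by

  refine ⟨partA T hT t, ?_, ?_, psi_trace T hT t, ?_⟩
  · intro A hA
    exact (le_sup_left : FbarRaw T t ≤ FbarDelta T hT t) _ (fst_lift T t A hA)
  · intro A hA
    refine (le_sup_left : FbarPlus T t ≤ FbarDeltaPlus T hT t) _ ?_
    unfold Fplus at hA
    unfold FbarPlus
    simp only [MeasurableSpace.measurableSet_iInf] at hA ⊢
    exact fun s hs => fst_lift T _ A (hA s hs)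
  · intro Abar hA
    rw [partA] at hA
    simp only [MeasurableSpace.measurableSet_iInf] at hA
    exact limsup_trace (Fraw T) (Fraw_mono T) t T _ _
      fun s hs => psi_trace T hT _ Abar (hA s hs)

end PathwiseSuperhedging
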